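/- arXiv:1903.08886 — 7 statements merged into one kernel-verified Lean document; each statement's English description precedes it below -/
import Mathlib

section
/- Let k be a nonnegative integer and let σ > 1 be real. Then (k!/(σ−1)^k)·(ζ(σ) − 1) ≤ ∑_{n=1}^∞ (log n)^k · n^{−σ} ≤ (k!/(σ−1)^k)·ζ(σ). (The middle expression equals (−1)^k times the k-th derivative of the Riemann zeta function at σ.) -/
/-- ζ(σ) = ∑_{n=1}^∞ n^{−σ} for real σ. -/
noncomputable def zetaR (σ : ℝ) : ℝ := ∑' n : ℕ, ((n : ℝ) + 1) ^ (-σ)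

open MeasureTheory Set
open scoped ENNReal

/-- The power `n ^ (-σ)` as an extended nonnegative real. -/
noncomputable def ennrealPow (σ : ℝ) (n : ℕ) : ℝ≥0∞ := ENNReal.ofReal ((n : ℝ) ^ (-σ))

theorem ennrealPow_mul (σ : ℝ) (m n : ℕ) :
    ennrealPow σ (m * n) = ennrealPow σ m * ennrealPow σ n := by
  unfold ennrealPow
  rw [← ENNReal.ofReal_mul (by positivity), Nat.cast_mul,
    Real.mul_rpow (by positivity) (by positivity)]

theorem ennrealPow_anti {σ : ℝ} (hσ : 0 ≤ σ) {m n : ℕ} (hm : 0 < m) (h : m ≤ n) :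
    ennrealPow σ n ≤ ennrealPow σ m := by
  refine ENNReal.ofReal_le_ofReal ?_
  exact Real.rpow_le_rpow_of_nonpos (by exact_mod_cast hm) (by exact_mod_cast h) (by linarith)

theorem natCast_mul_ennrealPow (σ : ℝ) {n : ℕ} (hn : 0 < n) :
    (n : ℝ≥0∞) * ennrealPow σ n = ENNReal.ofReal ((n : ℝ) ^ (1 - σ)) := by
  have h : (0 : ℝ) < n := by exact_mod_cast hn
  unfold ennrealPow
  rw [← ENNReal.ofReal_natCast, ← ENNReal.ofReal_mul h.le, sub_eq_add_neg, Real.rpow_add h,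
    Real.rpow_one]

theorem tsum_eq_tsum_blocks (a : ℕ → ℝ≥0∞) (N : ℕ) [NeZero N] :
    ∑' j, a j = ∑' q : ℕ, ∑ r : Fin N, a (q * N + r) := by
  rw [← (Nat.divModEquiv N).symm.tsum_eq a, ENNReal.tsum_prod']
  simp [tsum_fintype]

theorem tsum_tail_le {σ : ℝ} (hσ : 0 ≤ σ) (M : ℕ) :
    ∑' j, ennrealPow σ (j + M + 1) ≤
      ENNReal.ofReal (((M + 1 : ℕ) : ℝ) ^ (1 - σ)) * ∑' q, ennrealPow σ (q + 1) := by
  rw [tsum_eq_tsum_blocks _ (M + 1), ← natCast_mul_ennrealPow σ M.succ_pos, ← ENNReal.tsum_mul_left]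
  refine ENNReal.tsum_le_tsum fun q => ?_
  rw [mul_assoc, ← ennrealPow_mul]
  refine (Finset.sum_le_card_nsmul _ _ (ennrealPow σ ((M + 1) * (q + 1))) fun r _ =>
    ennrealPow_anti hσ (by positivity) (by nlinarith [r.2])).trans ?_
  simp

theorem le_tsum_tail {σ : ℝ} (hσ : 0 ≤ σ) {M : ℕ} (hM : 0 < M) :
    ENNReal.ofReal ((M : ℝ) ^ (1 - σ)) * ∑' q, ennrealPow σ (q + 2) ≤
      ∑' j, ennrealPow σ (j + M + 1) := by
  have : NeZero M := ⟨hM.ne'⟩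
  rw [tsum_eq_tsum_blocks (fun j => ennrealPow σ (j + M + 1)) M, ← natCast_mul_ennrealPow σ hM, ← ENNReal.tsum_mul_left]
  refine ENNReal.tsum_le_tsum fun q => ?_
  rw [mul_assoc, ← ennrealPow_mul]
  refine le_trans ?_ (Finset.card_nsmul_le_sum _ _ (ennrealPow σ (M * (q + 2))) fun r _ =>
    ennrealPow_anti hσ (by positivity) (by nlinarith [r.2]))
  simp

/-- The measure on `ℕ` giving mass `(n + 1) ^ (-σ)` to `n`. -/
noncomputable def zetaMeasure (σ : ℝ) : Measure ℕ :=
  Measure.count.withDensity fun n => ennrealPow σ (n + 1)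

theorem lintegral_zetaMeasure (σ : ℝ) (g : ℕ → ℝ≥0∞) :
    ∫⁻ n, g n ∂zetaMeasure σ = ∑' n, ennrealPow σ (n + 1) * g n := by
  rw [zetaMeasure, lintegral_withDensity_eq_lintegral_mul _ (measurable_of_countable _)
    (measurable_of_countable _), lintegral_count]
  rfl

theorem zetaMeasure_Ici (σ : ℝ) (M : ℕ) :
    zetaMeasure σ (Ici M) = ∑' j, ennrealPow σ (j + M + 1) := by
  rw [← lintegral_indicator_one measurableSet_Ici, lintegral_zetaMeasure,
    ← Summable.sum_add_tsum_nat_add' (k := M) ENNReal.summable,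
    Finset.sum_eq_zero, zero_add]
  · refine tsum_congr fun j => ?_
    simp
  · intro i hi
    simp [Finset.mem_range.1 hi]

theorem setOf_lt_log_eq_Ici (u : ℝ) :
    {n : ℕ | u < Real.log ((n : ℝ) + 1)} = Ici ⌊Real.exp u⌋₊ := by
  ext n
  rw [mem_ofPred_eq, mem_Ici, Real.lt_log_iff_exp_lt (by positivity), ← Nat.lt_add_one_iff,
    Nat.floor_lt (Real.exp_pos u).le]
  push_cast
  rfl

theorem zetaMeasure_lt_log_le {σ : ℝ} (hσ : 1 < σ) (u : ℝ) :
    zetaMeasure σ {n : ℕ | u < Real.log ((n : ℝ) + 1)} ≤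
      ENNReal.ofReal (Real.exp (-((σ - 1) * u))) * ∑' q, ennrealPow σ (q + 1) := by
  rw [setOf_lt_log_eq_Ici, zetaMeasure_Ici]
  refine (tsum_tail_le (by linarith) _).trans (mul_le_mul_left (ENNReal.ofReal_le_ofReal ?_) _)
  rw [show -((σ - 1) * u) = u * (1 - σ) by ring, Real.exp_mul]
  refine Real.rpow_le_rpow_of_nonpos (Real.exp_pos u) ?_ (by linarith)
  push_cast
  exact (Nat.lt_floor_add_one _).le

theorem le_zetaMeasure_lt_log {σ : ℝ} (hσ : 1 < σ) {u : ℝ} (hu : 0 ≤ u) :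
    ENNReal.ofReal (Real.exp (-((σ - 1) * u))) * ∑' q, ennrealPow σ (q + 2) ≤
      zetaMeasure σ {n : ℕ | u < Real.log ((n : ℝ) + 1)} := by
  have hM : 0 < ⌊Real.exp u⌋₊ := Nat.floor_pos.2 (Real.one_le_exp hu)
  rw [setOf_lt_log_eq_Ici, zetaMeasure_Ici]
  refine (mul_le_mul_left (ENNReal.ofReal_le_ofReal ?_) _).trans (le_tsum_tail (by linarith) hM)
  rw [show -((σ - 1) * u) = u * (1 - σ) by ring, Real.exp_mul]
  exact Real.rpow_le_rpow_of_nonpos (by exact_mod_cast hM) (Nat.floor_le (Real.exp_pos u).le)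
    (by linarith)

theorem ofReal_mul_lintegral_exp_mul_rpow {k : ℕ} (hk : k ≠ 0) {s : ℝ} (hs : 0 < s) :
    ENNReal.ofReal k * ∫⁻ u in Ioi (0 : ℝ),
      ENNReal.ofReal (Real.exp (-(s * u))) * ENNReal.ofReal (u ^ ((k : ℝ) - 1)) =
      ENNReal.ofReal (k.factorial / s ^ k) := by
  have hk0 : (0 : ℝ) < k := by exact_mod_cast Nat.pos_of_ne_zero hk
  have hI := Real.integral_rpow_mul_exp_neg_mul_Ioi hk0 hs
  have hpos : 0 < (1 / s) ^ (k : ℝ) * Real.Gamma k := by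
    have := Real.Gamma_pos_of_pos hk0
    positivity
  have hint : Integrable (fun u : ℝ => u ^ ((k : ℝ) - 1) * Real.exp (-(s * u)))
      (volume.restrict (Ioi 0)) := by
    by_contra h
    rw [integral_undef h] at hI
    exact hpos.ne hI
  have hnn : 0 ≤ᵐ[volume.restrict (Ioi 0)]
      fun u : ℝ => u ^ ((k : ℝ) - 1) * Real.exp (-(s * u)) := by
    filter_upwards [ae_restrict_mem measurableSet_Ioi] with u hu
    have : (0 : ℝ) < u := hu
    positivity
  have hcongr : ∫⁻ u in Ioi (0 : ℝ),
      ENNReal.ofReal (Real.exp (-(s * u))) * ENNReal.ofReal (u ^ ((k : ℝ) - 1)) =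
      ∫⁻ u in Ioi (0 : ℝ), ENNReal.ofReal (u ^ ((k : ℝ) - 1) * Real.exp (-(s * u))) := by
    refine lintegral_congr fun u => ?_
    rw [← ENNReal.ofReal_mul (Real.exp_pos _).le, mul_comm]
  rw [hcongr, ← ofReal_integral_eq_lintegral_ofReal hint hnn, hI, ← ENNReal.ofReal_mul hk0.le]
  congr 1
  rw [mul_left_comm, ← Real.Gamma_add_one hk0.ne', Real.Gamma_nat_eq_factorial, Real.rpow_natCast,
    one_div, inv_pow]
  ring

theorem tsum_log_pow_eq_lintegral (σ : ℝ) {k : ℕ} (hk : k ≠ 0) :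
    ∑' n : ℕ, ENNReal.ofReal (Real.log ((n : ℝ) + 1) ^ k * ((n : ℝ) + 1) ^ (-σ)) =
      ENNReal.ofReal k * ∫⁻ u in Ioi (0 : ℝ),
        zetaMeasure σ {n : ℕ | u < Real.log ((n : ℝ) + 1)} * ENNReal.ofReal (u ^ ((k : ℝ) - 1)) := by
  have hlog (n : ℕ) : 0 ≤ Real.log ((n : ℝ) + 1) := Real.log_nonneg (by simp)
  rw [← lintegral_rpow_eq_lintegral_meas_lt_mul (zetaMeasure σ) (ae_of_all _ hlog)
    (measurable_of_countable _).aemeasurable (by exact_mod_cast Nat.pos_of_ne_zero hk),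
    lintegral_zetaMeasure]
  refine tsum_congr fun n => ?_
  rw [Real.rpow_natCast, mul_comm, ENNReal.ofReal_mul (by positivity), ennrealPow, Nat.cast_add_one]

theorem tsum_log_pow_le {σ : ℝ} (hσ : 1 < σ) {k : ℕ} (hk : k ≠ 0) :
    ∑' n : ℕ, ENNReal.ofReal (Real.log ((n : ℝ) + 1) ^ k * ((n : ℝ) + 1) ^ (-σ)) ≤
      ENNReal.ofReal (k.factorial / (σ - 1) ^ k) * ∑' q, ennrealPow σ (q + 1) := by
  rw [tsum_log_pow_eq_lintegral σ hk, ← ofReal_mul_lintegral_exp_mul_rpow hk (sub_pos.2 hσ),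
    mul_assoc, ← lintegral_mul_const _ (by fun_prop)]
  gcongr ENNReal.ofReal k * ?_
  refine lintegral_mono fun u => ?_
  dsimp only
  rw [mul_right_comm]
  gcongr
  exact zetaMeasure_lt_log_le hσ u

theorem le_tsum_log_pow {σ : ℝ} (hσ : 1 < σ) {k : ℕ} (hk : k ≠ 0) :
    ENNReal.ofReal (k.factorial / (σ - 1) ^ k) * ∑' q, ennrealPow σ (q + 2) ≤
      ∑' n : ℕ, ENNReal.ofReal (Real.log ((n : ℝ) + 1) ^ k * ((n : ℝ) + 1) ^ (-σ)) := by
  rw [tsum_log_pow_eq_lintegral σ hk, ← ofReal_mul_lintegral_exp_mul_rpow hk (sub_pos.2 hσ),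
    mul_assoc, ← lintegral_mul_const _ (by fun_prop)]
  gcongr ENNReal.ofReal k * ?_
  refine setLIntegral_mono' measurableSet_Ioi fun u hu => ?_
  rw [mul_right_comm]
  gcongr
  exact le_zetaMeasure_lt_log hσ (le_of_lt hu)

theorem summable_add_one_rpow_neg {σ : ℝ} (hσ : 1 < σ) :
    Summable fun n : ℕ => ((n : ℝ) + 1) ^ (-σ) := by
  have h := (summable_nat_add_iff 1).2 (Real.summable_nat_rpow.2 (neg_lt_neg hσ))
  simpa using h

/-- For a nonnegative integer k and real σ > 1,
(k!/(σ−1)^k)·(ζ(σ) − 1) ≤ ∑_{n=1}^∞ (log n)^k · n^{−σ} ≤ (k!/(σ−1)^k)·ζ(σ). -/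
theorem stmt0 (k : ℕ) (σ : ℝ) (hσ : 1 < σ) :
    (k.factorial : ℝ) / (σ - 1) ^ k * (zetaR σ - 1) ≤
      (∑' n : ℕ, (Real.log ((n : ℝ) + 1)) ^ k * ((n : ℝ) + 1) ^ (-σ)) ∧
    (∑' n : ℕ, (Real.log ((n : ℝ) + 1)) ^ k * ((n : ℝ) + 1) ^ (-σ)) ≤
      (k.factorial : ℝ) / (σ - 1) ^ k * zetaR σ := by
  have hsum := summable_add_one_rpow_neg hσ
  have hpos (n : ℕ) : 0 ≤ ((n : ℝ) + 1) ^ (-σ) := by positivity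
  rcases eq_or_ne k 0 with rfl | hk
  · simp [zetaR]
  have hlog (n : ℕ) : 0 ≤ Real.log ((n : ℝ) + 1) := Real.log_nonneg (by simp)
  have hterm (n : ℕ) : 0 ≤ Real.log ((n : ℝ) + 1) ^ k * ((n : ℝ) + 1) ^ (-σ) :=
    mul_nonneg (pow_nonneg (hlog n) k) (hpos n)
  have hC : 0 ≤ (k.factorial : ℝ) / (σ - 1) ^ k := by
    have := sub_pos.2 hσ
    positivity
  have hZ : ∑' q, ennrealPow σ (q + 1) = ENNReal.ofReal (zetaR σ) := by
    rw [zetaR, ENNReal.ofReal_tsum_of_nonneg hpos hsum]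
    simp [ennrealPow]
  have hZ' : ∑' q, ennrealPow σ (q + 2) = ENNReal.ofReal (zetaR σ - 1) := by
    have h1 : zetaR σ - 1 = ∑' q : ℕ, (((q + 1 : ℕ) : ℝ) + 1) ^ (-σ) := by
      rw [zetaR, hsum.tsum_eq_zero_add]
      simp
    rw [h1, ENNReal.ofReal_tsum_of_nonneg (fun q => hpos (q + 1)) ((summable_nat_add_iff 1).2 hsum)]
    refine tsum_congr fun q => ?_
    rw [ennrealPow, ← Nat.cast_add_one]
  have hupper := tsum_log_pow_le hσ hk
  have hlower := le_tsum_log_pow hσ hk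
  rw [hZ, ← ENNReal.ofReal_mul hC] at hupper
  rw [hZ', ← ENNReal.ofReal_mul hC] at hlower
  have hsummable : Summable fun n : ℕ => Real.log ((n : ℝ) + 1) ^ k * ((n : ℝ) + 1) ^ (-σ) := by
    have h := ENNReal.summable_toReal (hupper.trans_lt ENNReal.ofReal_lt_top).ne
    simpa only [ENNReal.toReal_ofReal (hterm _)] using h
  rw [← ENNReal.ofReal_tsum_of_nonneg hterm hsummable] at hupper hlower
  exact ⟨(ENNReal.ofReal_le_ofReal_iff (tsum_nonneg hterm)).1 hlower,
    (ENNReal.ofReal_le_ofReal_iff (mul_nonneg hC (tsum_nonneg hpos))).1 hupper⟩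
end

section
/- For 1 < σ₁ ≤ σ₂ one has (σ₁ − 1)·ζ(σ₁) ≤ (σ₂ − 1)·ζ(σ₂); that is, the function σ ↦ (σ−1)ζ(σ) is nondecreasing on (1, ∞). -/
/-- If the partial sums of `d` are nonnegative and `r` is nonnegative and antitone, then the
partial sums of `d * r` are nonnegative. -/
theorem sum_mul_nonneg_of_antitone {d r : ℕ → ℝ} (hd : ∀ N, 0 ≤ ∑ n ∈ Finset.range N, d n)
    (hr : Antitone r) (hr0 : ∀ n, 0 ≤ r n) (N : ℕ) :
    0 ≤ ∑ n ∈ Finset.range N, d n * r n := by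
  have key : ∀ N, r N * ∑ n ∈ Finset.range N, d n ≤ ∑ n ∈ Finset.range N, d n * r n := by
    intro N
    induction N with
    | zero => simp
    | succ N ih =>
      calc r (N + 1) * ∑ n ∈ Finset.range (N + 1), d n
          ≤ r N * ∑ n ∈ Finset.range (N + 1), d n :=
            mul_le_mul_of_nonneg_right (hr N.le_succ) (hd _)
        _ ≤ ∑ n ∈ Finset.range (N + 1), d n * r n := by
            rw [Finset.sum_range_succ, Finset.sum_range_succ]
            linarith
  exact (mul_nonneg (hr0 N) (hd N)).trans (key N)

theorem one_sub_rpow_neg_pos {t u : ℝ} (ht : 0 < t) (hu : 0 < u) : 0 < 1 - (1 + u) ^ (-t) :=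
  sub_pos.2 (Real.rpow_lt_one_of_one_lt_of_neg (by linarith) (by linarith))

/-- `t ↦ t / (1 - (1 + u) ^ (-t))` is nondecreasing, in cross-multiplied form. -/
theorem mul_one_sub_rpow_neg_le_of_exponent_le {s t u : ℝ} (hs : 0 < s) (hst : s ≤ t)
    (hu : 0 < u) : s * (1 - (1 + u) ^ (-t)) ≤ t * (1 - (1 + u) ^ (-s)) := by
  have ht : 0 < t := hs.trans_le hst
  have hx : 0 < (1 + u) ^ (-t) := Real.rpow_pos_of_pos (by linarith) _
  have h := rpow_one_add_le_one_add_mul_self (s := (1 + u) ^ (-t) - 1) (by linarith)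
    (div_pos hs ht).le ((div_le_one ht).2 hst)
  rw [add_sub_cancel, ← Real.rpow_mul (by linarith),
    show -t * (s / t) = -s by field_simp] at h
  have h' := mul_le_mul_of_nonneg_left h ht.le
  rw [mul_add, ← mul_assoc, mul_div_cancel₀ s ht.ne'] at h'
  linarith

/-- `u ↦ u / (1 - (1 + u) ^ (-t))` is nondecreasing, in cross-multiplied form. -/
theorem mul_one_sub_rpow_neg_le_of_base_le {t u v : ℝ} (ht : 0 < t) (hu : 0 < u) (huv : u ≤ v) :
    u * (1 - (1 + v) ^ (-t)) ≤ v * (1 - (1 + u) ^ (-t)) := by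
  have hv : 0 < v := hu.trans_le huv
  have hl : 0 ≤ u / v := (div_pos hu hv).le
  have hl1 : u / v ≤ 1 := (div_le_one hv).2 huv
  have hx : 0 < (1 + v) ^ (-t) := Real.rpow_pos_of_pos (by linarith) _
  have h1 := rpow_one_add_le_one_add_mul_self (s := v) (by linarith) hl hl1
  rw [div_mul_cancel₀ u hv.ne'] at h1
  have h2 := rpow_one_add_le_one_add_mul_self (s := (1 + v) ^ (-t) - 1) (by linarith) hl hl1
  have h3 := Real.rpow_le_rpow_of_nonpos (Real.rpow_pos_of_pos (by linarith) _) h1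
    (neg_nonpos.2 ht.le)
  rw [add_sub_cancel, ← Real.rpow_mul (by linarith), mul_comm, Real.rpow_mul (by linarith)] at h2
  have h' := mul_le_mul_of_nonneg_left (h3.trans h2) hv.le
  rw [mul_add, ← mul_assoc, mul_div_cancel₀ u hv.ne'] at h'
  linarith

/-- The ratio of `t * (n + 1) ^ (-(t + 1))` to `(n + 1) ^ (-t) - (n + 2) ^ (-t)`. -/
noncomputable def zetaRatio (t : ℝ) (n : ℕ) : ℝ :=
  t * ((n : ℝ) + 1)⁻¹ / (1 - (1 + ((n : ℝ) + 1)⁻¹) ^ (-t))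

theorem zetaRatio_nonneg {t : ℝ} (ht : 0 < t) (n : ℕ) : 0 ≤ zetaRatio t n :=
  div_nonneg (by positivity) (one_sub_rpow_neg_pos ht (by positivity)).le

theorem zetaRatio_antitone {t : ℝ} (ht : 0 < t) : Antitone (zetaRatio t) := by
  intro m n hmn
  have huv : ((n : ℝ) + 1)⁻¹ ≤ ((m : ℝ) + 1)⁻¹ := by gcongr
  unfold zetaRatio
  rw [div_le_div_iff₀ (one_sub_rpow_neg_pos ht (by positivity))
    (one_sub_rpow_neg_pos ht (by positivity)), mul_assoc, mul_assoc]
  exact mul_le_mul_of_nonneg_left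
    (mul_one_sub_rpow_neg_le_of_base_le ht (by positivity) huv) ht.le

theorem zetaRatio_mono {s t : ℝ} (hs : 0 < s) (hst : s ≤ t) (n : ℕ) :
    zetaRatio s n ≤ zetaRatio t n := by
  unfold zetaRatio
  have hu : 0 < ((n : ℝ) + 1)⁻¹ := by positivity
  rw [div_le_div_iff₀ (one_sub_rpow_neg_pos hs hu) (one_sub_rpow_neg_pos (hs.trans_le hst) hu)]
  have h := mul_le_mul_of_nonneg_right (mul_one_sub_rpow_neg_le_of_exponent_le hs hst hu) hu.le
  linarith

theorem sub_mul_zetaRatio {t : ℝ} (ht : 0 < t) (n : ℕ) :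
    (((n : ℝ) + 1) ^ (-t) - (((n + 1 : ℕ) : ℝ) + 1) ^ (-t)) * zetaRatio t n =
      t * ((n : ℝ) + 1) ^ (-(t + 1)) := by
  have hn : 0 < (n : ℝ) + 1 := by positivity
  have hq := one_sub_rpow_neg_pos ht (inv_pos.2 hn)
  have h : ((n + 1 : ℕ) : ℝ) + 1 = ((n : ℝ) + 1) * (1 + ((n : ℝ) + 1)⁻¹) := by
    push_cast; field_simp
  rw [h, Real.mul_rpow hn.le (by positivity), ← mul_one_sub, zetaRatio, mul_assoc,
    mul_div_cancel₀ _ hq.ne', neg_add, Real.rpow_add hn, Real.rpow_neg_one]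
  ring

theorem mul_sum_rpow_neg_le {s t : ℝ} (hs : 0 < s) (hst : s ≤ t) (N : ℕ) :
    s * ∑ n ∈ Finset.range N, ((n : ℝ) + 1) ^ (-(s + 1)) ≤
      t * ∑ n ∈ Finset.range N, ((n : ℝ) + 1) ^ (-(t + 1)) := by
  have ht : 0 < t := hs.trans_le hst
  let w : ℝ → ℕ → ℝ := fun t n => ((n : ℝ) + 1) ^ (-t) - (((n + 1 : ℕ) : ℝ) + 1) ^ (-t)
  have hw : ∀ n, 0 ≤ w t n := fun n => sub_nonneg.2 <|
    Real.rpow_le_rpow_of_nonpos (by positivity) (by push_cast; linarith) (by linarith)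
  have hsum : ∀ N, ∑ n ∈ Finset.range N, (w t n - w s n) =
      ((N : ℝ) + 1) ^ (-s) - ((N : ℝ) + 1) ^ (-t) := by
    intro N
    rw [Finset.sum_sub_distrib, Finset.sum_range_sub' (fun n : ℕ => ((n : ℝ) + 1) ^ (-t)),
      Finset.sum_range_sub' (fun n : ℕ => ((n : ℝ) + 1) ^ (-s))]
    simp
  have habel := sum_mul_nonneg_of_antitone (d := fun n => w t n - w s n) (fun N => by
    rw [hsum, sub_nonneg]
    exact Real.rpow_le_rpow_of_exponent_le (by simp) (by linarith))
    (zetaRatio_antitone hs) (zetaRatio_nonneg hs) N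
  simp_rw [sub_mul, Finset.sum_sub_distrib] at habel
  calc s * ∑ n ∈ Finset.range N, ((n : ℝ) + 1) ^ (-(s + 1))
      = ∑ n ∈ Finset.range N, w s n * zetaRatio s n := by
        rw [Finset.mul_sum]
        exact Finset.sum_congr rfl fun n _ => (sub_mul_zetaRatio hs n).symm
    _ ≤ ∑ n ∈ Finset.range N, w t n * zetaRatio s n := sub_nonneg.1 habel
    _ ≤ ∑ n ∈ Finset.range N, w t n * zetaRatio t n :=
        Finset.sum_le_sum fun n _ => mul_le_mul_of_nonneg_left (zetaRatio_mono hs hst n) (hw n)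
    _ = t * ∑ n ∈ Finset.range N, ((n : ℝ) + 1) ^ (-(t + 1)) := by
        rw [Finset.mul_sum]
        exact Finset.sum_congr rfl fun n _ => sub_mul_zetaRatio ht n

theorem tendsto_sum_zetaR {σ : ℝ} (hσ : 1 < σ) :
    Filter.Tendsto (fun N => ∑ n ∈ Finset.range N, ((n : ℝ) + 1) ^ (-σ)) Filter.atTop
      (nhds (zetaR σ)) := by
  have h := (summable_nat_add_iff 1).2 (Real.summable_nat_rpow.2 (neg_lt_neg hσ))
  push_cast at h
  exact h.hasSum.tendsto_sum_nat

/-- The function σ ↦ (σ−1)ζ(σ) is nondecreasing on (1, ∞). -/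
theorem stmt2 (σ₁ σ₂ : ℝ) (h1 : 1 < σ₁) (h12 : σ₁ ≤ σ₂) :
    (σ₁ - 1) * zetaR σ₁ ≤ (σ₂ - 1) * zetaR σ₂ := by
  refine le_of_tendsto_of_tendsto' ((tendsto_sum_zetaR h1).const_mul _)
    ((tendsto_sum_zetaR (h1.trans_le h12)).const_mul _) fun N => ?_
  simpa only [sub_add_cancel] using
    mul_sum_rpow_neg_le (sub_pos.2 h1) (sub_le_sub_right h12 1) N
end

section
/- Let c ∈ ℂ and r ∈ ℝ with Re c − 1/2 ≥ r > 0, and set ξ = (Re c − 1/2) + √((Re c − 1/2)² − r²). Then for every square-summable sequence (a_n)_{n≥1} of complex numbers, ∑_{k=0}^∞ (r^{2k}/(k!)²)·|∑_{n=1}^∞ a_n (−log n)^k n^{−c}|² ≤ ζ(1+ξ)·∑_{n=1}^∞ |a_n|². -/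
theorem sum_range_le_of_unimodal {f F : ℝ → ℝ} {M : ℝ} (hM : 1 ≤ M)
    (hF : ∀ x, 1 ≤ x → HasDerivAt F (f x) x) (hmono : MonotoneOn f (Set.Icc 1 M))
    (hanti : AntitoneOn f (Set.Ici M)) (N : ℕ) :
    ∑ n ∈ Finset.range (N + 1), f ((n : ℝ) + 1) ≤
      F ((N : ℝ) + 1) - F 1 + f (min ((N : ℝ) + 1) M) := by
  induction N with
  | zero => simp [hM]
  | succ N ih =>
    rw [Finset.sum_range_succ]
    have hN : (0 : ℝ) ≤ N := N.cast_nonneg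
    obtain ⟨y, ⟨hy1, hy2⟩, hy⟩ := exists_hasDerivAt_eq_slope F f
      (show (N : ℝ) + 1 < (N : ℝ) + 1 + 1 by linarith)
      (fun x hx => (hF x (by linarith [hx.1])).continuousAt.continuousWithinAt)
      (fun x hx => hF x (by linarith [hx.1]))
    rw [show (N : ℝ) + 1 + 1 - (N + 1) = 1 by ring, div_one] at hy
    push_cast
    suffices f ((N : ℝ) + 1 + 1) + f (min ((N : ℝ) + 1) M) ≤
        f y + f (min ((N : ℝ) + 1 + 1) M) by linarith
    rcases le_total ((N : ℝ) + 1 + 1) M with h | h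
    · rw [min_eq_left h, min_eq_left (by linarith)]
      linarith [hmono ⟨by linarith, by linarith⟩ ⟨by linarith, by linarith⟩ hy1.le]
    · rw [min_eq_right h]
      rcases le_total M ((N : ℝ) + 1) with h' | h'
      · rw [min_eq_right h']
        linarith [hanti (by simp; linarith) (by simpa using h) hy2.le]
      · rw [min_eq_left h']
        rcases le_total y M with h'' | h''
        · linarith [hmono ⟨by linarith, by linarith⟩ ⟨by linarith, h''⟩ hy1.le,
            hanti Set.self_mem_Ici h h]
        · linarith [hanti h'' h hy2.le,
            hmono ⟨by linarith, by linarith⟩ (Set.right_mem_Icc.2 hM) h']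

theorem two_mul_pow_div_factorial_le_exp (k : ℕ) :
    2 * ((k + 1 : ℝ) ^ (k + 1) / (k + 1).factorial) ≤ Real.exp (k + 1) := by
  have h := Real.sum_le_exp_of_nonneg (x := (k + 1 : ℝ)) (by positivity) (k + 2)
  rw [Finset.sum_range_succ, Finset.sum_range_succ] at h
  have h0 : 0 ≤ ∑ i ∈ Finset.range k, (k + 1 : ℝ) ^ i / i.factorial :=
    Finset.sum_nonneg fun _ _ => by positivity
  have h1 : (k + 1 : ℝ) ^ k / k.factorial = (k + 1 : ℝ) ^ (k + 1) / (k + 1).factorial := by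
    rw [Nat.factorial_succ, pow_succ]; push_cast; field_simp
  linarith

theorem hasDerivAt_exp_neg_mul_sum {ξ : ℝ} (hξ : 0 < ξ) (k : ℕ) (t : ℝ) :
    HasDerivAt (fun t => -(Real.exp (-ξ * t) / ξ) * ∑ j ∈ Finset.range (k + 1), (ξ * t) ^ j / j.factorial)
      (Real.exp (-ξ * t) * ((ξ * t) ^ k / k.factorial)) t := by
  have he : HasDerivAt (fun t => -(Real.exp (-ξ * t) / ξ)) (Real.exp (-ξ * t)) t := by
    refine ((((hasDerivAt_id t).const_mul (-ξ)).exp).div_const ξ).neg.congr_deriv ?_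
    simp only [id_eq]; field_simp
  induction k with
  | zero => simpa using he
  | succ k ih =>
    have hp : HasDerivAt (fun t => (ξ * t) ^ (k + 1) / ((k + 1).factorial : ℝ))
        (ξ * ((ξ * t) ^ k / k.factorial)) t := by
      refine ((((hasDerivAt_id t).const_mul ξ).pow (k + 1)).div_const _).congr_deriv ?_
      rw [Nat.factorial_succ]; push_cast; simp only [id_eq]; field_simp
    simp_rw [Finset.sum_range_succ _ (k + 1), mul_add]
    refine (ih.add (he.mul hp)).congr_deriv ?_
    field_simp; ring

theorem hasDerivAt_pow_mul_exp (k : ℕ) (s t : ℝ) :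
    HasDerivAt (fun t => t ^ (k + 1) * Real.exp (-s * t))
      (t ^ k * Real.exp (-s * t) * ((k + 1 : ℝ) - s * t)) t := by
  have h := (hasDerivAt_pow (k + 1) t).mul (((hasDerivAt_id t).const_mul (-s)).exp)
  refine h.congr_deriv ?_
  simp only [id_eq, add_tsub_cancel_right]; push_cast; ring

theorem monotoneOn_pow_mul_exp (k : ℕ) {s : ℝ} (hs : 0 < s) :
    MonotoneOn (fun t => t ^ (k + 1) * Real.exp (-s * t)) (Set.Icc 0 ((k + 1 : ℝ) / s)) := by
  refine monotoneOn_of_hasDerivWithinAt_nonneg (convex_Icc _ _) (by fun_prop)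
    (fun x _ => (hasDerivAt_pow_mul_exp k s x).hasDerivWithinAt) fun x hx => ?_
  rw [interior_Icc] at hx
  have h := (lt_div_iff₀ hs).1 hx.2
  have h0 := hx.1
  exact mul_nonneg (by positivity) (by linarith)

theorem antitoneOn_pow_mul_exp (k : ℕ) {s : ℝ} (hs : 0 < s) :
    AntitoneOn (fun t => t ^ (k + 1) * Real.exp (-s * t)) (Set.Ici ((k + 1 : ℝ) / s)) := by
  refine antitoneOn_of_hasDerivWithinAt_nonpos (convex_Ici _) (by fun_prop)
    (fun x _ => (hasDerivAt_pow_mul_exp k s x).hasDerivWithinAt) fun x hx => ?_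
  rw [interior_Ici] at hx
  have h := (div_lt_iff₀ hs).1 hx
  have h0 : 0 < x := lt_trans (by positivity) hx
  exact mul_nonpos_of_nonneg_of_nonpos (by positivity) (by linarith)

theorem rpow_trapezoid {ξ x : ℝ} (hξ : 0 < ξ) (hx : 0 < x) :
    (x ^ (-ξ) - (x + 1) ^ (-ξ)) / ξ ≤ (x ^ (-(1 + ξ)) + (x + 1) ^ (-(1 + ξ))) / 2 := by
  set G : ℝ → ℝ := fun y => (x ^ (-(1 + ξ)) + y ^ (-(1 + ξ))) * (y - x) / 2 + y ^ (-ξ) / ξ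
  have hG : ∀ y, x ≤ y → HasDerivAt G
      ((x ^ (-(1 + ξ)) - y ^ (-(1 + ξ)) - (1 + ξ) * y ^ (-(1 + ξ) - 1) * (y - x)) / 2) y := by
    intro y hy
    have hy0 : 0 < y := hx.trans_le hy
    have h := ((((Real.hasDerivAt_rpow_const (p := -(1 + ξ)) (Or.inl hy0.ne')).const_add
      (x ^ (-(1 + ξ)))).mul ((hasDerivAt_id y).sub_const x)).div_const 2).add
      ((Real.hasDerivAt_rpow_const (p := -ξ) (Or.inl hy0.ne')).div_const ξ)
    refine h.congr_deriv ?_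
    rw [show -ξ - 1 = -(1 + ξ) by ring]
    simp only [id_eq]
    field_simp
    ring
  have hmono : MonotoneOn G (Set.Ici x) := by
    refine monotoneOn_of_hasDerivWithinAt_nonneg (convex_Ici _)
      (fun y hy => (hG y hy).continuousAt.continuousWithinAt)
      (fun y hy => (hG y (interior_subset hy)).hasDerivWithinAt) fun y hy => ?_
    have hy' : x ≤ y := interior_subset hy
    have hy0 : 0 < y := hx.trans_le hy'
    have hu : 0 < x / y := by positivity
    have h1 : (x / y) ^ (-(1 + ξ)) = x ^ (-(1 + ξ)) / y ^ (-(1 + ξ)) :=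
      Real.div_rpow hx.le hy0.le _
    have h2 : 1 - (1 + ξ) * (x / y - 1) ≤ (x / y) ^ (-(1 + ξ)) := by
      rw [Real.rpow_def_of_pos hu]
      nlinarith [Real.add_one_le_exp (Real.log (x / y) * -(1 + ξ)), Real.log_le_sub_one_of_pos hu]
    have hyp : 0 < y ^ (-(1 + ξ)) := by positivity
    rw [h1, le_div_iff₀ hyp] at h2
    rw [Real.rpow_sub_one hy0.ne']
    have h3 : (1 + ξ) * (y ^ (-(1 + ξ)) / y) * (y - x) =
        - ((1 + ξ) * (x / y - 1)) * y ^ (-(1 + ξ)) := by field_simp; ring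
    rw [h3]
    linarith
  have h := hmono Set.self_mem_Ici (show x ≤ x + 1 by linarith) (by linarith)
  simp only [G] at h
  rw [sub_div]
  linarith

theorem one_div_add_half_le_tsum {ξ : ℝ} (hξ : 0 < ξ) :
    1 / ξ + 1 / 2 ≤ ∑' n : ℕ, ((n : ℝ) + 1) ^ (-(1 + ξ)) := by
  have hsum : Summable fun n : ℕ => ((n : ℝ) + 1) ^ (-(1 + ξ)) := by
    have := (summable_nat_add_iff 1).2 (Real.summable_nat_rpow.2 (show -(1 + ξ) < -1 by linarith))
    simpa using this
  have hpart : ∀ N : ℕ, 1 / 2 + ((N : ℝ) + 1) ^ (-(1 + ξ)) / 2 + (1 - ((N : ℝ) + 1) ^ (-ξ)) / ξ ≤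
      ∑ n ∈ Finset.range (N + 1), ((n : ℝ) + 1) ^ (-(1 + ξ)) := by
    intro N
    induction N with
    | zero => norm_num
    | succ N ih =>
      rw [Finset.sum_range_succ]
      have := rpow_trapezoid hξ (show (0 : ℝ) < N + 1 by positivity)
      push_cast
      rw [sub_div] at *
      linarith
  have hlim : Filter.Tendsto (fun N : ℕ => 1 / 2 + (1 - ((N : ℝ) + 1) ^ (-ξ)) / ξ)
      Filter.atTop (nhds (1 / 2 + (1 - 0) / ξ)) := by
    refine (((tendsto_rpow_neg_atTop hξ).comp ?_).const_sub 1 |>.div_const ξ).const_add _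
    exact Filter.tendsto_atTop_add_const_right _ _ tendsto_natCast_atTop_atTop
  have := le_of_tendsto hlim (Filter.Eventually.of_forall fun N => by
    have h1 := hpart N
    have h2 := hsum.sum_le_tsum (Finset.range (N + 1)) (fun n _ => by positivity)
    have h3 : 0 ≤ ((N : ℝ) + 1) ^ (-(1 + ξ)) := by positivity
    show _ ≤ ∑' n : ℕ, ((n : ℝ) + 1) ^ (-(1 + ξ))
    linarith)
  linarith [sub_zero (1 : ℝ)]

theorem summable_and_tsum_log_pow_le {ξ : ℝ} (hξ : 0 < ξ) (k : ℕ) :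
    (Summable fun n : ℕ =>
      (ξ * Real.log ((n : ℝ) + 1)) ^ k / k.factorial * ((n : ℝ) + 1) ^ (-(1 + ξ))) ∧
    ∑' n : ℕ, (ξ * Real.log ((n : ℝ) + 1)) ^ k / k.factorial * ((n : ℝ) + 1) ^ (-(1 + ξ)) ≤
      ∑' n : ℕ, ((n : ℝ) + 1) ^ (-(1 + ξ)) := by
  rcases k with _ | k
  · have := (summable_nat_add_iff 1).2 (Real.summable_nat_rpow.2 (show -(1 + ξ) < -1 by linarith))
    simpa using this
  have hs : 0 < 1 + ξ := by linarith
  set f : ℝ → ℝ := fun x =>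
    (ξ * Real.log x) ^ (k + 1) / (k + 1).factorial * x ^ (-(1 + ξ)) with hf
  set Φ : ℝ → ℝ := fun t =>
    -(Real.exp (-ξ * t) / ξ) * ∑ j ∈ Finset.range (k + 1 + 1), (ξ * t) ^ j / j.factorial with hΦ
  set g : ℝ → ℝ := fun t => t ^ (k + 1) * Real.exp (-(1 + ξ) * t) with hg
  have hfg : ∀ x, 1 ≤ x → f x = ξ ^ (k + 1) / (k + 1).factorial * g (Real.log x) := by
    intro x hx
    simp only [hf, hg]
    rw [Real.rpow_def_of_pos (by linarith), mul_comm (Real.log x) (-(1 + ξ)), mul_pow]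
    ring
  have hM : 1 ≤ Real.exp ((k + 1 : ℝ) / (1 + ξ)) := Real.one_le_exp (by positivity)
  have hF : ∀ x, 1 ≤ x → HasDerivAt (fun x => Φ (Real.log x)) (f x) x := by
    intro x hx
    have hx0 : 0 < x := by linarith
    refine ((hasDerivAt_exp_neg_mul_sum hξ (k + 1) (Real.log x)).comp x
      (Real.hasDerivAt_log hx0.ne')).congr_deriv ?_
    simp only [hf]
    rw [neg_add, Real.rpow_add hx0, Real.rpow_neg_one, Real.rpow_def_of_pos hx0,
      mul_comm (Real.log x) (-ξ)]
    ring
  have hmono : MonotoneOn f (Set.Icc 1 (Real.exp ((k + 1 : ℝ) / (1 + ξ)))) := by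
    intro x hx y hy hxy
    have hx0 : 0 < x := by linarith [hx.1]
    have hy0 : 0 < y := by linarith [hy.1]
    rw [hfg x hx.1, hfg y hy.1]
    exact mul_le_mul_of_nonneg_left (monotoneOn_pow_mul_exp k hs
      ⟨Real.log_nonneg hx.1, (Real.log_le_iff_le_exp hx0).2 hx.2⟩
      ⟨Real.log_nonneg hy.1, (Real.log_le_iff_le_exp hy0).2 hy.2⟩
      (Real.log_le_log hx0 hxy)) (by positivity)
  have hanti : AntitoneOn f (Set.Ici (Real.exp ((k + 1 : ℝ) / (1 + ξ)))) := by
    intro x hx y hy hxy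
    have hx1 : 1 ≤ x := hM.trans hx
    have hy1 : 1 ≤ y := hM.trans hy
    have hx0 : 0 < x := by linarith
    have hy0 : 0 < y := by linarith
    rw [hfg x hx1, hfg y hy1]
    exact mul_le_mul_of_nonneg_left (antitoneOn_pow_mul_exp k hs
      ((Real.le_log_iff_exp_le hx0).2 hx) ((Real.le_log_iff_exp_le hy0).2 hy)
      (Real.log_le_log hx0 hxy)) (by positivity)
  have hmax : f (Real.exp ((k + 1 : ℝ) / (1 + ξ))) ≤ 1 / 2 := by
    rw [hfg _ hM, Real.log_exp]
    simp only [hg]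
    have h1 : -(1 + ξ) * ((k + 1 : ℝ) / (1 + ξ)) = -(k + 1) := by field_simp
    have h2 : (ξ / (1 + ξ)) ^ (k + 1) ≤ 1 :=
      pow_le_one₀ (by positivity) ((div_le_one hs).2 (by linarith))
    have h3 : (k + 1 : ℝ) ^ (k + 1) / (k + 1).factorial * Real.exp (-(k + 1)) ≤ 1 / 2 := by
      rw [Real.exp_neg, ← div_eq_mul_inv, div_le_iff₀ (Real.exp_pos _)]
      linarith [two_mul_pow_div_factorial_le_exp k]
    rw [h1]
    calc _ = (ξ / (1 + ξ)) ^ (k + 1) *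
          ((k + 1 : ℝ) ^ (k + 1) / (k + 1).factorial * Real.exp (-(k + 1))) := by
            rw [div_pow, div_pow]; ring
      _ ≤ 1 * (1 / 2) := mul_le_mul h2 h3 (by positivity) zero_le_one
      _ = 1 / 2 := one_mul _
  have hnonneg : ∀ n : ℕ, 0 ≤ f ((n : ℝ) + 1) := fun n => by
    have : 0 ≤ Real.log ((n : ℝ) + 1) := Real.log_nonneg (by linarith [n.cast_nonneg (α := ℝ)])
    positivity
  have hle_max : ∀ x, 1 ≤ x → f (min x (Real.exp ((k + 1 : ℝ) / (1 + ξ)))) ≤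
      f (Real.exp ((k + 1 : ℝ) / (1 + ξ))) := fun x hx =>
    hmono ⟨le_min hx hM, min_le_right _ _⟩ (Set.right_mem_Icc.2 hM) (min_le_right _ _)
  have hbound : ∀ N : ℕ, ∑ n ∈ Finset.range N, f ((n : ℝ) + 1) ≤ 1 / ξ + 1 / 2 := by
    intro N
    have hN : (1 : ℝ) ≤ N + 1 := by linarith [N.cast_nonneg (α := ℝ)]
    have h0 : Φ (Real.log ((N : ℝ) + 1)) ≤ 0 := by
      have := Real.log_nonneg hN
      exact mul_nonpos_of_nonpos_of_nonneg (neg_nonpos.2 (by positivity))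
        (Finset.sum_nonneg fun _ _ => by positivity)
    have h1 : Φ (Real.log 1) = -(1 / ξ) := by
      simp [hΦ, Finset.sum_range_succ' _ (k + 1)]
    have h2 := sum_range_le_of_unimodal hM hF hmono hanti N
    rw [Finset.sum_range_succ] at h2
    linarith [hnonneg N, hle_max _ hN]
  have hsummable := summable_of_sum_range_le hnonneg hbound
  exact ⟨hsummable, (hsummable.tsum_le_of_sum_range_le hbound).trans
    (one_div_add_half_le_tsum hξ)⟩

theorem norm_tsum_sq_le_of_cauchy_schwarz {u : ℕ → ℂ} {p q : ℕ → ℝ} (hp : ∀ n, 0 ≤ p n)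
    (hq : ∀ n, 0 ≤ q n) (hps : Summable p) (hqs : Summable q) (hu : ∀ n, ‖u n‖ ^ 2 = p n * q n) :
    ‖∑' n, u n‖ ^ 2 ≤ (∑' n, p n) * ∑' n, q n := by
  have hu' : ∀ n, ‖u n‖ = √(p n) * √(q n) := fun n => by
    rw [← Real.sqrt_mul (hp n), ← hu, Real.sqrt_sq (norm_nonneg _)]
  have hpsq : ∀ n, √(p n) ^ (2 : ℝ) = p n := fun n => by
    rw [Real.rpow_two, Real.sq_sqrt (hp n)]
  have hqsq : ∀ n, √(q n) ^ (2 : ℝ) = q n := fun n => by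
    rw [Real.rpow_two, Real.sq_sqrt (hq n)]
  obtain ⟨hs, hle⟩ := Real.summable_and_inner_le_Lp_mul_Lq_tsum_of_nonneg
    Real.HolderConjugate.two_two
    (fun n => Real.sqrt_nonneg (p n)) (fun n => Real.sqrt_nonneg (q n))
    (by simpa only [hpsq] using hps) (by simpa only [hqsq] using hqs)
  simp only [hpsq, hqsq, ← hu', ← Real.sqrt_eq_rpow] at hs hle
  have hP : 0 ≤ ∑' n, p n := tsum_nonneg hp
  have hQ : 0 ≤ ∑' n, q n := tsum_nonneg hq
  calc ‖∑' n, u n‖ ^ 2 ≤ (√(∑' n, p n) * √(∑' n, q n)) ^ 2 :=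
        pow_le_pow_left₀ (norm_nonneg _) ((norm_tsum_le_tsum_norm hs).trans hle) 2
    _ = _ := by rw [mul_pow, Real.sq_sqrt hP, Real.sq_sqrt hQ]

/-- The upper bound for the composition operator with symbol φ(s) = c + r·2^{−s}:
‖f∘φ‖²_{ℋ²} = ∑_k (r^{2k}/(k!)²)|f^{(k)}(c)|² ≤ ζ(1+ξ)·‖f‖²_{ℋ²}, where
ξ = (Re c − 1/2) + √((Re c − 1/2)² − r²). -/
theorem stmt7 (c : ℂ) (r : ℝ) (hr : 0 < r) (hrc : r ≤ c.re - 1 / 2)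
    (a : ℕ → ℂ) (ha : Summable fun n => ‖a n‖ ^ 2) :
    ∑' k : ℕ, (r ^ (2 * k) / (k.factorial : ℝ) ^ 2) *
        ‖∑' n : ℕ, a n * ((-Real.log ((n : ℝ) + 1) : ℝ) : ℂ) ^ k * ((n : ℂ) + 1) ^ (-c)‖ ^ 2 ≤
      zetaR (1 + ((c.re - 1 / 2) + Real.sqrt ((c.re - 1 / 2) ^ 2 - r ^ 2))) *
        ∑' n : ℕ, ‖a n‖ ^ 2 := by
  set b : ℝ := Real.sqrt ((c.re - 1 / 2) ^ 2 - r ^ 2) with hb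
  set ξ : ℝ := (c.re - 1 / 2) + b with hξdef
  have hb0 : 0 ≤ b := Real.sqrt_nonneg _
  have hb2 : b ^ 2 = (c.re - 1 / 2) ^ 2 - r ^ 2 := Real.sq_sqrt (by nlinarith)
  have hξ : 0 < ξ := by linarith
  set δ : ℝ := r ^ 2 / ξ with hδ
  have hδ0 : 0 ≤ δ := by positivity
  have hδξ : δ + (1 + ξ) = 2 * c.re := by
    have : δ = c.re - 1 / 2 - b := by
      rw [hδ, div_eq_iff hξ.ne']
      rw [hξdef]
      linear_combination hb2
    linarith
  have hδmul : δ * ξ = r ^ 2 := div_mul_cancel₀ _ hξ.ne'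
  set l : ℕ → ℝ := fun n => Real.log ((n : ℝ) + 1) with hl
  have hl0 : ∀ n, 0 ≤ l n := fun n => Real.log_nonneg (by linarith [n.cast_nonneg (α := ℝ)])
  set G : ℕ → ℕ → ℝ := fun n k =>
    ‖a n‖ ^ 2 * ((n : ℝ) + 1) ^ (-δ) * ((δ * l n) ^ k / k.factorial) with hG
  have hG0 : ∀ n k, 0 ≤ G n k := fun n k => by have := hl0 n; positivity
  have hGsum : ∀ n, HasSum (G n) (‖a n‖ ^ 2) := by
    intro n
    have h := (NormedSpace.expSeries_div_hasSum_exp (δ * l n)).mul_left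
      (‖a n‖ ^ 2 * ((n : ℝ) + 1) ^ (-δ))
    rw [← Real.exp_eq_exp_ℝ] at h
    have hval : ‖a n‖ ^ 2 * ((n : ℝ) + 1) ^ (-δ) * Real.exp (δ * l n) = ‖a n‖ ^ 2 := by
      rw [Real.rpow_def_of_pos (by positivity), mul_assoc, ← Real.exp_add,
        show Real.log ((n : ℝ) + 1) * -δ + δ * l n = 0 by simp only [hl]; ring, Real.exp_zero,
        mul_one]
    rwa [hval] at h
  have hprod : Summable (Function.uncurry G) := by
    refine (summable_prod_of_nonneg fun x => hG0 x.1 x.2).2 ⟨fun n => (hGsum n).summable, ?_⟩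
    simpa only [Function.uncurry_apply_pair, (hGsum _).tsum_eq] using ha
  have hswap : ∑' k, ∑' n, G n k = ∑' n, ‖a n‖ ^ 2 := by
    rw [hprod.tsum_comm]
    exact tsum_congr fun n => (hGsum n).tsum_eq
  have hprod' : Summable (Function.uncurry fun k n => G n k) := hprod.prod_symm
  have hcol : ∀ k, Summable fun n => G n k := fun k => hprod'.prod_factor k
  have houter : Summable fun k => ∑' n, G n k := hprod'.prod
  have hterm : ∀ k : ℕ, (r ^ (2 * k) / (k.factorial : ℝ) ^ 2) *
      ‖∑' n : ℕ, a n * ((-Real.log ((n : ℝ) + 1) : ℝ) : ℂ) ^ k * ((n : ℂ) + 1) ^ (-c)‖ ^ 2 ≤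
      zetaR (1 + ξ) * ∑' n, G n k := by
    intro k
    obtain ⟨hs, hle⟩ := summable_and_tsum_log_pow_le hξ k
    set w : ℝ := r ^ (2 * k) / (k.factorial : ℝ) ^ 2 with hw
    have hw0 : 0 < w := by positivity
    have hcs := norm_tsum_sq_le_of_cauchy_schwarz
      (u := fun n => a n * ((-Real.log ((n : ℝ) + 1) : ℝ) : ℂ) ^ k * ((n : ℂ) + 1) ^ (-c))
      (p := fun n => w⁻¹ * G n k) (fun n => mul_nonneg (by positivity) (hG0 n k))
      (fun n => by have := hl0 n; positivity) ((hcol k).mul_left _) hs (fun n => by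
        have hn : (0 : ℝ) < (n : ℝ) + 1 := by positivity
        have h1 : ‖((n : ℂ) + 1) ^ (-c)‖ = ((n : ℝ) + 1) ^ (-c.re) := by
          have := Complex.norm_cpow_eq_rpow_re_of_pos hn (-c)
          simpa using this
        have h2 : (((n : ℝ) + 1) ^ (-c.re)) ^ 2 =
            ((n : ℝ) + 1) ^ (-δ) * ((n : ℝ) + 1) ^ (-(1 + ξ)) := by
          rw [← Real.rpow_add hn, ← Real.rpow_natCast, ← Real.rpow_mul hn.le]
          congr 1
          push_cast
          linarith
        rw [norm_mul, norm_mul, norm_pow, h1, Complex.norm_real, norm_neg,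
          Real.norm_of_nonneg (hl0 n), mul_pow, mul_pow, h2]
        simp only [hG, hw, hl, mul_pow]
        rw [pow_mul, ← hδmul, mul_pow]
        have hδ1 : δ ≠ 0 := by positivity
        field_simp)
    rw [tsum_mul_left] at hcs
    have hGk : 0 ≤ ∑' n, G n k := tsum_nonneg fun n => hG0 n k
    calc _ ≤ w * (w⁻¹ * (∑' n, G n k) * zetaR (1 + ξ)) := by
          refine mul_le_mul_of_nonneg_left (hcs.trans ?_) hw0.le
          exact mul_le_mul_of_nonneg_left hle (by positivity)
      _ = _ := by field_simp
  rw [← hswap, ← tsum_mul_left]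
  exact Summable.tsum_le_tsum hterm
    (Summable.of_nonneg_of_le (fun k => by positivity) hterm (houter.mul_left _))
    (houter.mul_left _)
end

section
/- Let (c_n)_{n≥1} be complex numbers with ∑_{n≥1} |c_n| n^{−σ} < ∞ for every σ > 1/2, define φ(s) = ∑_{n≥1} c_n n^{−s} for Re s > 1/2, and assume Re c_1 > 1/2 and that c_n ≠ 0 for some n ≥ 2. Suppose C ≥ 0 is a constant such that for every square-summable complex sequence (a_n)_{n≥1} there exist θ > 1/2 and a square-summable complex sequence (b_n)_{n≥1} with ∑_{n=1}^∞ b_n n^{−s} = ∑_{n=1}^∞ a_n n^{−φ(s)} for all s with Re s > θ (both series converging absolutely there) and ∑_{n=1}^∞ |b_n|² ≤ C·∑_{n=1}^∞ |a_n|². Then C > ζ(2 Re c_1). -/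
open Filter Topology LSeries ComplexConjugate

/-- The `n`-th Dirichlet coefficient, for `n ≥ 1`, of the series `∑ c n (n + 1) ^ (-s)`. -/
def dirichletCoeff (c : ℕ → ℂ) (n : ℕ) : ℂ := c (n - 1)

lemma term_dirichletCoeff_succ (c : ℕ → ℂ) (s : ℂ) (n : ℕ) :
    term (dirichletCoeff c) s (n + 1) = c n * ((n : ℂ) + 1) ^ (-s) := by
  simp [dirichletCoeff, Complex.cpow_neg, div_eq_mul_inv]

lemma lseriesSummable_dirichletCoeff_iff {c : ℕ → ℂ} {s : ℂ} :
    LSeriesSummable (dirichletCoeff c) s ↔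
      Summable fun n : ℕ => ‖c n * ((n : ℂ) + 1) ^ (-s)‖ := by
  rw [summable_norm_iff, LSeriesSummable, ← summable_nat_add_iff 1]
  simp only [term_dirichletCoeff_succ]

lemma lseries_dirichletCoeff {c : ℕ → ℂ} {s : ℂ}
    (h : LSeriesSummable (dirichletCoeff c) s) :
    LSeries (dirichletCoeff c) s = ∑' n : ℕ, c n * ((n : ℂ) + 1) ^ (-s) := by
  rw [LSeries, h.tsum_eq_zero_add]
  simp only [term_dirichletCoeff_succ, term_zero, zero_add]

@[simp]
lemma dirichletCoeff_one : dirichletCoeff 1 = 1 := rfl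

lemma norm_natCast_add_one_cpow (n : ℕ) (s : ℂ) :
    ‖((n : ℂ) + 1) ^ s‖ = ((n : ℝ) + 1) ^ s.re := by
  have := Complex.norm_cpow_eq_rpow_re_of_pos (x := (n : ℝ) + 1) (by positivity) s
  simpa using this

/-- An L-series that is eventually constant on the real axis has no coefficients beyond
the first one. -/
lemma coeff_eq_zero_of_lseries_eventually_const {f : ℕ → ℂ} {v : ℂ}
    (hf : abscissaOfAbsConv f < ⊤) (h : ∀ᶠ x : ℝ in atTop, LSeries f x = v)
    {n : ℕ} (hn : 2 ≤ n) : f n = 0 := by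
  have hδ : abscissaOfAbsConv (v • delta) < ⊤ := by
    have hs : LSeriesSummable (v • delta) 0 := by
      refine LSeriesSummable.smul v (summable_of_ne_finset_zero (s := {1}) fun m hm => ?_)
      rw [term_delta, if_neg (by simpa using hm)]
    exact hs.abscissaOfAbsConv_le.trans_lt (EReal.coe_lt_top _)
  have := LSeries.eq_of_LSeries_eventually_eq hf hδ (n := n)
    (by filter_upwards [h] with x hx; simp [hx, LSeries_smul, LSeries_delta]) (by omega)
  rw [this]
  simp [delta, show n ≠ 1 by omega]

lemma lseries_logMul_one_ne_zero {x : ℝ} (hx : 1 < x) : LSeries (logMul 1) x ≠ 0 := by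
  have hs : LSeriesSummable (logMul 1) (x : ℂ) :=
    LSeriesSummable_logMul_of_lt_re (by rw [abscissaOfAbsConv_one]; exact_mod_cast hx)
  have key (n : ℕ) : term (logMul 1) (x : ℂ) n = ((Real.log n / (n : ℝ) ^ x : ℝ) : ℂ) := by
    rcases eq_or_ne n 0 with rfl | hn
    · simp
    · rw [term_of_ne_zero hn]
      simp [logMul, Complex.ofReal_cpow (Nat.cast_nonneg n), Complex.natCast_log]
  have hs' : Summable fun n : ℕ => Real.log n / (n : ℝ) ^ x := by
    have h := hs
    rw [LSeriesSummable, funext key] at h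
    exact_mod_cast h
  rw [LSeries, tsum_congr key, ← Complex.ofReal_tsum, Complex.ofReal_ne_zero]
  refine (hs'.tsum_pos (fun n => ?_) 2 ?_).ne'
  · exact div_nonneg (Real.log_natCast_nonneg n) (by positivity)
  · exact div_pos (Real.log_pos (by norm_num)) (by positivity)

lemma eventually_lseries_one_add_ne {w u : ℂ} {x : ℝ} (hx : 1 < x) (hw : w + u = x) (v : ℂ) :
    ∀ᶠ z in 𝓝[≠] w, LSeries 1 (z + u) ≠ v := by
  have h : HasDerivAt (LSeries 1) (-LSeries (logMul 1) (w + u)) (w + u) :=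
    LSeries_hasDerivAt (by rw [abscissaOfAbsConv_one, hw]; exact_mod_cast hx)
  exact (h.comp_add_const w u).eventually_ne
    (neg_ne_zero.mpr (hw ▸ lseries_logMul_one_ne_zero hx))

lemma zetaR_summable {x : ℝ} (hx : 1 < x) : Summable fun n : ℕ => ((n : ℝ) + 1) ^ (-x) := by
  have := (summable_nat_add_iff 1).mpr (Real.summable_nat_rpow.mpr (neg_lt_neg hx))
  exact_mod_cast this

lemma zetaR_pos {x : ℝ} (hx : 1 < x) : 0 < zetaR x :=
  (zetaR_summable hx).tsum_pos (fun n => by positivity) 0 (by positivity)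

lemma lseries_one_eq_tsum {s : ℂ} (hs : 1 < s.re) :
    LSeries 1 s = ∑' n : ℕ, ((n : ℂ) + 1) ^ (-s) := by
  have h : LSeriesSummable (dirichletCoeff 1) s := LSeriesSummable_one_iff.mpr hs
  simpa using lseries_dirichletCoeff h

lemma lseries_one_eq_zetaR {x : ℝ} (hx : 1 < x) : LSeries 1 (x : ℂ) = zetaR x := by
  rw [lseries_one_eq_tsum (by simpa using hx), zetaR, Complex.ofReal_tsum]
  refine tsum_congr fun n => ?_
  rw [Complex.ofReal_cpow (by positivity)]
  simp

/-- If the non-constant Dirichlet series φ(s) = ∑_{n≥1} cₙ n^{−s} (here `c n` is the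
coefficient of (n+1)^{−s}) generates a composition operator on ℋ² with squared norm at
most C, then C > ζ(2 Re c₁); i.e. the general lower bound is never attained by a
non-constant symbol. -/
theorem stmt8 (c : ℕ → ℂ)
    (hsum : ∀ σ : ℝ, 1 / 2 < σ → Summable fun n : ℕ => ‖c n‖ * ((n : ℝ) + 1) ^ (-σ))
    (hre : 1 / 2 < (c 0).re)
    (hnc : ∃ n : ℕ, 1 ≤ n ∧ c n ≠ 0)
    (C : ℝ) (hC0 : 0 ≤ C)
    (hbd : ∀ a : ℕ → ℂ, Summable (fun n => ‖a n‖ ^ 2) →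
      ∃ θ : ℝ, 1 / 2 < θ ∧ ∃ b : ℕ → ℂ, Summable (fun n => ‖b n‖ ^ 2) ∧
        (∀ s : ℂ, θ < s.re →
          Summable (fun n : ℕ => ‖b n * ((n : ℂ) + 1) ^ (-s)‖) ∧
          Summable (fun n : ℕ =>
            ‖a n * ((n : ℂ) + 1) ^ (-(∑' m : ℕ, c m * ((m : ℂ) + 1) ^ (-s)))‖) ∧
          ∑' n : ℕ, b n * ((n : ℂ) + 1) ^ (-s) =
            ∑' n : ℕ, a n * ((n : ℂ) + 1) ^ (-(∑' m : ℕ, c m * ((m : ℂ) + 1) ^ (-s)))) ∧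
        ∑' n : ℕ, ‖b n‖ ^ 2 ≤ C * ∑' n : ℕ, ‖a n‖ ^ 2) :
    zetaR (2 * (c 0).re) < C := by
  set w := c 0 with hw
  have hx : 1 < 2 * w.re := by linarith
  have hwu : w + conj w = ((2 * w.re : ℝ) : ℂ) := by rw [Complex.add_conj]
  set Z := zetaR (2 * w.re) with hZ
  have hZpos : 0 < Z := zetaR_pos hx
  have hφs (s : ℂ) (hs : 1 / 2 < s.re) : LSeriesSummable (dirichletCoeff c) s := by
    rw [lseriesSummable_dirichletCoeff_iff]
    refine (hsum _ hs).congr fun n => ?_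
    rw [norm_mul, norm_natCast_add_one_cpow, Complex.neg_re]
  have hφa : abscissaOfAbsConv (dirichletCoeff c) < ⊤ :=
    (hφs 1 (by norm_num)).abscissaOfAbsConv_le.trans_lt (EReal.coe_lt_top _)
  have hφlim : Tendsto (fun x : ℝ => LSeries (dirichletCoeff c) x) atTop (𝓝 w) :=
    LSeries.tendsto_atTop hφa
  have hnorm (n : ℕ) : ‖((n : ℂ) + 1) ^ (-conj w)‖ ^ 2 = ((n : ℝ) + 1) ^ (-(2 * w.re)) := by
    rw [norm_natCast_add_one_cpow, ← Real.rpow_mul_natCast (by positivity)]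
    simp [mul_comm]
  obtain ⟨θ, hθ, b, hb, hs, hle⟩ := hbd (fun n => ((n : ℂ) + 1) ^ (-conj w))
    ((zetaR_summable hx).congr fun n => (hnorm n).symm)
  rw [tsum_congr hnorm] at hle
  change _ ≤ C * Z at hle
  have hbs (s : ℂ) (h : θ < s.re) : LSeriesSummable (dirichletCoeff b) s :=
    lseriesSummable_dirichletCoeff_iff.mpr (hs s h).1
  have hba : abscissaOfAbsConv (dirichletCoeff b) < ⊤ :=
    (hbs ((θ + 1 : ℝ) : ℂ) (by simp)).abscissaOfAbsConv_le.trans_lt (EReal.coe_lt_top _)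
  have hblim : Tendsto (fun x : ℝ => LSeries (dirichletCoeff b) x) atTop (𝓝 (b 0)) :=
    LSeries.tendsto_atTop hba
  have hre_ev : ∀ᶠ x : ℝ in atTop, 1 / 2 < (LSeries (dirichletCoeff c) x).re :=
    ((Complex.continuous_re.tendsto w).comp hφlim).eventually (lt_mem_nhds hre)
  have hcomp : ∀ᶠ x : ℝ in atTop,
      LSeries (dirichletCoeff b) x = LSeries 1 (LSeries (dirichletCoeff c) x + conj w) := by
    filter_upwards [hre_ev, eventually_gt_atTop θ] with x hx1 hxθ
    have hxθ' : θ < (x : ℂ).re := by simpa using hxθ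
    rw [lseries_dirichletCoeff (hbs x hxθ'), (hs x hxθ').2.2,
      ← lseries_dirichletCoeff (hφs x (hθ.trans hxθ')),
      lseries_one_eq_tsum (by rw [Complex.add_re, Complex.conj_re]; linarith)]
    refine tsum_congr fun n => ?_
    rw [← Complex.cpow_add _ _ (Nat.cast_add_one_ne_zero n), neg_add_rev]
  have hderiv : ContinuousAt (fun z => LSeries 1 (z + conj w)) w :=
    ((LSeries_hasDerivAt (f := 1) (s := w + conj w) (by
      rw [abscissaOfAbsConv_one, hwu]; exact_mod_cast hx)).comp_add_const w (conj w)).continuousAt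
  have hb0 : b 0 = Z := by
    refine tendsto_nhds_unique (hblim.congr' hcomp) ?_
    have := hderiv.tendsto.comp hφlim
    rwa [hwu, lseries_one_eq_zetaR hx] at this
  by_contra! hC
  have hbn (n : ℕ) (hn : n ≠ 0) : b n = 0 := by
    have h1 := hb.sum_le_tsum {0, n} fun i _ => by positivity
    rw [Finset.sum_pair hn.symm, hb0, Complex.norm_real, Real.norm_eq_abs, sq_abs] at h1
    have h2 : C * Z ≤ Z * Z := mul_le_mul_of_nonneg_right hC hZpos.le
    have h3 : ‖b n‖ ^ 2 = 0 := le_antisymm (by nlinarith) (by positivity)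
    simpa using h3
  have hconst : ∀ᶠ x : ℝ in atTop, LSeries (dirichletCoeff c) x = w := by
    have hne := eventually_nhdsWithin_iff.mp (eventually_lseries_one_add_ne hx hwu Z)
    filter_upwards [hφlim.eventually hne, hcomp, eventually_gt_atTop θ] with x h1 h2 hxθ
    by_contra h3
    refine h1 h3 ?_
    rw [← h2, lseries_dirichletCoeff (hbs x (by simpa using hxθ)),
      tsum_eq_single 0 fun n hn => by simp [hbn n hn]]
    simp [hb0]
  obtain ⟨n, hn, hcn⟩ := hnc
  exact hcn (coeff_eq_zero_of_lseries_eventually_const hφa hconst (n := n + 1) (by omega))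
end

section
/- Let c ∈ ℂ and r ∈ ℝ with Re c − 1/2 ≥ r > 0, and set ξ = (Re c − 1/2) + √((Re c − 1/2)² − r²). Then sup_{0 < x < 1} (2−x)·x·ζ(2 Re c − 2r(1−x)) ≥ 1/ξ. (Note that 2 Re c − 2r(1−x) > 1 for all 0 < x < 1, so the zeta values are finite.) -/
theorem zetaR_le {s : ℝ} (hs : 1 < s) : zetaR s ≤ 1 + 1 / (s - 1) := by
  have h := ZetaAsymptotics.zeta_limit_aux1 hs
  have h0 : 0 ≤ s * ZetaAsymptotics.termTSum s :=
    mul_nonneg (by linarith) (tsum_nonneg fun n ↦ ZetaAsymptotics.term_nonneg (n + 1) s)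
  have he : zetaR s = ∑' n : ℕ, 1 / (n + 1 : ℝ) ^ s :=
    tsum_congr fun n ↦ by rw [Real.rpow_neg (by positivity), one_div]
  rw [he]
  linarith

theorem rpow_one_sub_sub_le {x s : ℝ} (hx : 0 < x) (hs : 1 < s) :
    x ^ (1 - s) - (x + 1) ^ (1 - s) ≤ (s - 1) * x ^ (-s) := by
  have ht : 0 < 1 + 1 / x := by positivity
  have h1 : (x + 1) ^ (1 - s) = x ^ (1 - s) * (1 + 1 / x) ^ (1 - s) := by
    rw [← Real.mul_rpow hx.le ht.le]
    congr 1
    field_simp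
  have h2 : x ^ (1 - s) = x * x ^ (-s) := by
    rw [sub_eq_add_neg, Real.rpow_add hx, Real.rpow_one]
  have h3 : 1 + (1 - s) * (1 / x) ≤ (1 + 1 / x) ^ (1 - s) := by
    rw [Real.rpow_def_of_pos ht]
    have h4 := Real.add_one_le_exp (Real.log (1 + 1 / x) * (1 - s))
    have h5 := Real.log_le_sub_one_of_pos ht
    nlinarith
  have h6 := mul_le_mul_of_nonneg_left h3 (Real.rpow_nonneg hx.le (1 - s))
  rw [← h1] at h6
  have h7 : x ^ (1 - s) * (1 + (1 - s) * (1 / x)) = x ^ (1 - s) + (1 - s) * x ^ (-s) := by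
    rw [h2]
    field_simp
  linarith

theorem summable_zetaR {s : ℝ} (hs : 1 < s) : Summable fun n : ℕ ↦ ((n : ℝ) + 1) ^ (-s) := by
  have h := (summable_nat_add_iff 1).2 (Real.summable_nat_rpow (p := -s) |>.2 (by linarith))
  simpa using h

theorem one_div_sub_one_le_zetaR {s : ℝ} (hs : 1 < s) : 1 / (s - 1) ≤ zetaR s := by
  have hpart : ∀ N : ℕ, 1 - ((N : ℝ) + 1) ^ (1 - s) ≤ (s - 1) * zetaR s := by
    intro N
    have h1 : 1 - ((N : ℝ) + 1) ^ (1 - s) ≤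
        (s - 1) * ∑ n ∈ Finset.range N, ((n : ℝ) + 1) ^ (-s) := by
      induction N with
      | zero => simp
      | succ k ih =>
        rw [Finset.sum_range_succ, mul_add]
        have := rpow_one_sub_sub_le (x := (k : ℝ) + 1) (by positivity) hs
        push_cast
        linarith
    refine h1.trans (mul_le_mul_of_nonneg_left ?_ (by linarith))
    exact (summable_zetaR hs).sum_le_tsum _ fun n _ ↦ by positivity
  have hlim : Filter.Tendsto (fun N : ℕ ↦ 1 - ((N : ℝ) + 1) ^ (1 - s)) Filter.atTop
      (nhds (1 - 0)) := by
    refine Filter.Tendsto.sub tendsto_const_nhds ?_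
    have h := (tendsto_rpow_neg_atTop (show 0 < s - 1 by linarith)).comp
      (Filter.tendsto_atTop_add_const_right _ (1 : ℝ) (tendsto_natCast_atTop_atTop (R := ℝ)))
    simpa [Function.comp_def] using h
  have h := le_of_tendsto' hlim hpart
  rw [div_le_iff₀ (by linarith)]
  linarith

/-- For φ(s) = c + r·2^{−s} with Re c − 1/2 ≥ r > 0, one has
sup_{0<x<1} (2−x)x·ζ(2Re c − 2r(1−x)) ≥ 1/ξ with
ξ = (Re c − 1/2) + √((Re c − 1/2)² − r²). -/
theorem stmt9 (c : ℂ) (r : ℝ) (hr : 0 < r) (hrc : r ≤ c.re - 1 / 2) :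
    1 / ((c.re - 1 / 2) + Real.sqrt ((c.re - 1 / 2) ^ 2 - r ^ 2)) ≤
      sSup { y : ℝ | ∃ x : ℝ, 0 < x ∧ x < 1 ∧
        y = (2 - x) * x * zetaR (2 * c.re - 2 * r * (1 - x)) } := by
  obtain ⟨a, ha⟩ : ∃ a, a = c.re - 1 / 2 := ⟨_, rfl⟩
  have hσ : ∀ x : ℝ, 2 * c.re - 2 * r * (1 - x) = 1 + 2 * (a - r * (1 - x)) := by
    intro x
    rw [ha]
    ring
  simp only [hσ]
  rw [← ha] at hrc ⊢
  set S := { y : ℝ | ∃ x : ℝ, 0 < x ∧ x < 1 ∧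
    y = (2 - x) * x * zetaR (1 + 2 * (a - r * (1 - x))) }
  have hpos : ∀ x : ℝ, 0 < x → 0 < a - r * (1 - x) := fun x hx ↦ by nlinarith [mul_pos hr hx]
  have hbdd : BddAbove S := by
    refine ⟨2 + 1 / r, ?_⟩
    rintro y ⟨x, hx0, hx1, rfl⟩
    have hp := hpos x hx0
    have h1 := zetaR_le (s := 1 + 2 * (a - r * (1 - x))) (by linarith)
    have h2 : 1 / (1 + 2 * (a - r * (1 - x)) - 1) ≤ 1 / (2 * (r * x)) :=
      one_div_le_one_div_of_le (by positivity) (by linarith)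
    calc (2 - x) * x * zetaR (1 + 2 * (a - r * (1 - x)))
        ≤ (2 - x) * x * (1 + 1 / (2 * (r * x))) :=
          mul_le_mul_of_nonneg_left (by linarith) (mul_nonneg (by linarith) hx0.le)
      _ = (2 - x) * x + (1 - x / 2) * (1 / r) := by
          field_simp
      _ ≤ 2 + 1 / r := by
          have : 0 < 1 / r := by positivity
          nlinarith
  have hle : ∀ x : ℝ, 0 < x → x < 1 → (2 - x) * x / (2 * (a - r * (1 - x))) ≤ sSup S := by
    intro x hx0 hx1
    have hp := hpos x hx0
    refine le_trans ?_ (le_csSup hbdd ⟨x, hx0, hx1, rfl⟩)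
    have h1 := one_div_sub_one_le_zetaR (s := 1 + 2 * (a - r * (1 - x))) (by linarith)
    rw [add_sub_cancel_left] at h1
    rw [div_eq_mul_one_div]
    exact mul_le_mul_of_nonneg_left h1 (mul_nonneg (by linarith) hx0.le)
  rcases hrc.eq_or_lt with rfl | hlt
  · rw [sub_self, Real.sqrt_zero, add_zero]
    by_contra! hcon
    have hd : 0 < (1 / r - sSup S) * r := mul_pos (by linarith) hr
    have hx0 : 0 < min (1 / 2) ((1 / r - sSup S) * r) := lt_min (by norm_num) hd
    have hx1 := min_le_left (1 / 2) ((1 / r - sSup S) * r)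
    have hxd := min_le_right (1 / 2) ((1 / r - sSup S) * r)
    set x := min (1 / 2) ((1 / r - sSup S) * r)
    have h := hle x hx0 (by linarith)
    have he : (2 - x) * x / (2 * (r - r * (1 - x))) = (2 - x) / (2 * r) := by
      have : r - r * (1 - x) = r * x := by ring
      rw [this]
      field_simp
    rw [he, div_le_iff₀ (by positivity)] at h
    have h1 : (1 / r - sSup S) * r = 1 - sSup S * r := by field_simp
    linarith
  · have hq : 0 < a ^ 2 - r ^ 2 := by nlinarith
    have hs := Real.sqrt_pos.2 hq
    have hs2 := Real.sq_sqrt hq.le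
    set s := Real.sqrt (a ^ 2 - r ^ 2)
    have hsa : s < a := by nlinarith
    have hr2 : r ^ 2 = (a - s) * (a + s) := by linarith
    have hu0 : 0 < (a - s) / r := div_pos (by linarith) hr
    have hu1 : (a - s) / r < 1 := by
      rw [div_lt_one hr]
      nlinarith
    have h := hle (1 - (a - s) / r) (by linarith) (by linarith)
    convert h using 1
    have h1 : a - r * (1 - (1 - (a - s) / r)) = s := by field_simp; ring
    have h2 : (2 - (1 - (a - s) / r)) * (1 - (a - s) / r) = 2 * s / (a + s) := by
      have h3 : (2 - (1 - (a - s) / r)) * (1 - (a - s) / r) = 1 - (a - s) ^ 2 / r ^ 2 := by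
        ring
      have h4 : a - s ≠ 0 := by linarith
      have h5 : a + s ≠ 0 := by linarith
      rw [h3, hr2]
      field_simp
      ring
    have h5 : a + s ≠ 0 := by linarith
    rw [h1, h2]
    field_simp
end

section
/- Let 0 < ξ ≤ 1/4. Then for every x with 0 < x < 1, (2−x)·x·ζ(1 + 2ξx) ≤ 1/ξ. Consequently, sup_{0<x<1} (2−x)·x·ζ(1+2ξx) = 1/ξ. -/
open Filter Topology

theorem zetaR_eq_one_div_add {s : ℝ} (hs : 1 < s) :
    zetaR s = 1 / (s - 1) + (1 - s * ZetaAsymptotics.termTSum s) := by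
  rw [← ZetaAsymptotics.zeta_limit_aux1 hs, add_sub_cancel, zetaR]
  refine tsum_congr fun n ↦ ?_
  rw [Real.rpow_neg (by positivity), one_div]

theorem zetaR_le_one_div_add_one {s : ℝ} (hs : 1 < s) : zetaR s ≤ 1 / (s - 1) + 1 := by
  have h : 0 ≤ ZetaAsymptotics.termTSum s :=
    tsum_nonneg fun n ↦ ZetaAsymptotics.term_nonneg (n + 1) s
  rw [zetaR_eq_one_div_add hs]
  linarith [mul_nonneg (zero_le_one.trans hs.le) h]

theorem tendsto_mul_zetaR_nhdsGT_zero {ξ : ℝ} (h0 : 0 < ξ) :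
    Tendsto (fun x : ℝ ↦ (2 - x) * x * zetaR (1 + 2 * ξ * x)) (𝓝[>] 0) (𝓝 (1 / ξ)) := by
  let G : ℝ → ℝ := fun x ↦ (2 - x) / (2 * ξ) + (2 - x) * x *
    (1 - (1 + 2 * ξ * x) * ZetaAsymptotics.termTSum (1 + 2 * ξ * x))
  have hterm : ContinuousOn (fun x : ℝ ↦ ZetaAsymptotics.termTSum (1 + 2 * ξ * x))
      (Set.Ici 0) := by
    refine ZetaAsymptotics.continuousOn_termTSum.comp (by fun_prop) fun x hx ↦ ?_
    have hx' : 0 ≤ x := hx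
    simp only [Set.mem_Ici]
    nlinarith [mul_nonneg h0.le hx']
  have hG : ContinuousOn G (Set.Ici 0) := by
    fun_prop
  have hG0 : G 0 = 1 / ξ := by
    simp only [G]
    field_simp
    ring
  rw [← hG0]
  refine ((hG 0 Set.self_mem_Ici).mono_left
    (nhdsWithin_mono _ Set.Ioi_subset_Ici_self)).congr' ?_
  filter_upwards [self_mem_nhdsWithin] with x hx
  have hx' : 0 < x := hx
  rw [zetaR_eq_one_div_add (by linarith [mul_pos h0 hx'])]
  simp only [G, add_sub_cancel_left]
  field_simp

theorem mul_zetaR_le_one_div {ξ : ℝ} (h0 : 0 < ξ) (h14 : ξ ≤ 1 / 4) {x : ℝ} (hx0 : 0 < x)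
    (hx1 : x < 1) : (2 - x) * x * zetaR (1 + 2 * ξ * x) ≤ 1 / ξ := by
  have hz := zetaR_le_one_div_add_one (s := 1 + 2 * ξ * x) (by linarith [mul_pos h0 hx0])
  rw [add_sub_cancel_left] at hz
  calc (2 - x) * x * zetaR (1 + 2 * ξ * x)
      ≤ (2 - x) * x * (1 / (2 * ξ * x) + 1) :=
        mul_le_mul_of_nonneg_left hz (mul_nonneg (by linarith) hx0.le)
    _ = ((2 - x) * (1 + 2 * ξ * x) / 2) / ξ := by field_simp
    _ ≤ 1 / ξ := by
        gcongr
        nlinarith [mul_pos hx0 hx0, mul_pos h0 (mul_pos hx0 hx0),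
          mul_le_mul_of_nonneg_right h14 hx0.le]

/-- For 0 < ξ ≤ 1/4: (2−x)·x·ζ(1+2ξx) ≤ 1/ξ for all 0 < x < 1, and consequently
sup_{0<x<1} (2−x)·x·ζ(1+2ξx) = 1/ξ. -/
theorem stmt10 (ξ : ℝ) (h0 : 0 < ξ) (h14 : ξ ≤ 1 / 4) :
    (∀ x : ℝ, 0 < x → x < 1 → (2 - x) * x * zetaR (1 + 2 * ξ * x) ≤ 1 / ξ) ∧
    sSup { y : ℝ | ∃ x : ℝ, 0 < x ∧ x < 1 ∧
      y = (2 - x) * x * zetaR (1 + 2 * ξ * x) } = 1 / ξ := by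
  refine ⟨fun x hx0 hx1 ↦ mul_zetaR_le_one_div h0 h14 hx0 hx1, ?_⟩
  refine csSup_eq_of_forall_le_of_forall_lt_exists_gt ⟨_, 1 / 2, by norm_num, by norm_num, rfl⟩
    ?_ fun w hw ↦ ?_
  · rintro y ⟨x, hx0, hx1, rfl⟩
    exact mul_zetaR_le_one_div h0 h14 hx0 hx1
  · obtain ⟨x, hwx, hx0, hx1⟩ := (((tendsto_mul_zetaR_nhdsGT_zero h0).eventually_const_lt hw).and
      (Ioo_mem_nhdsGT zero_lt_one)).exists
    exact ⟨_, ⟨x, hx0, hx1, rfl⟩, hwx⟩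
end

section
/- Let Λ be a set of positive integers and σ_Λ ∈ ℝ a number such that ∑_{n∈Λ} n^{−σ} < ∞ for every σ > σ_Λ. Let φ be a function on H = {s : Re s > σ_Λ/2} with Re φ(s) > 1/2 for all s ∈ H. Suppose C ≥ 0 is a constant such that for every square-summable complex sequence (a_n)_{n≥1} there exists a square-summable complex sequence (b_n)_{n≥1} vanishing for n ∉ Λ, with ∑_{n=1}^∞ |b_n|² ≤ C·∑_{n=1}^∞ |a_n|² and ∑_{n∈Λ} b_n n^{−s} = ∑_{n=1}^∞ a_n n^{−φ(s)} for every s ∈ H. Then for every w ∈ H, ∑_{n=1}^∞ n^{−2 Re φ(w)} ≤ C·∑_{n∈Λ} n^{−2 Re w}. -/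
/-- Cauchy-Schwarz for square-summable families of complex numbers. -/
theorem norm_tsum_mul_sq_le {ι : Type*} {f g : ι → ℂ} (hf : Summable fun i => ‖f i‖ ^ 2)
    (hg : Summable fun i => ‖g i‖ ^ 2) :
    ‖∑' i, f i * g i‖ ^ 2 ≤ (∑' i, ‖f i‖ ^ 2) * ∑' i, ‖g i‖ ^ 2 := by
  have hfg : Summable fun i => ‖f i * g i‖ := by
    refine Summable.of_nonneg_of_le (fun _ => norm_nonneg _) (fun i => ?_) (hf.add hg)
    rw [norm_mul]
    nlinarith [sq_nonneg (‖f i‖ - ‖g i‖), sq_nonneg (‖f i‖ + ‖g i‖)]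
  have hAB : 0 ≤ (∑' i, ‖f i‖ ^ 2) * ∑' i, ‖g i‖ ^ 2 :=
    mul_nonneg (tsum_nonneg fun _ => sq_nonneg _) (tsum_nonneg fun _ => sq_nonneg _)
  rw [← Real.le_sqrt (norm_nonneg _) hAB]
  refine (norm_tsum_le_tsum_norm hfg).trans (hfg.tsum_le_of_sum_le fun s => ?_)
  refine Real.le_sqrt_of_sq_le ?_
  simp only [norm_mul]
  refine (Finset.sum_mul_sq_le_sq_mul_sq s _ _).trans ?_
  exact mul_le_mul (hf.sum_le_tsum s fun _ _ => sq_nonneg _)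
    (hg.sum_le_tsum s fun _ _ => sq_nonneg _) (Finset.sum_nonneg fun _ _ => sq_nonneg _)
    (tsum_nonneg fun _ => sq_nonneg _)

/-- The square of the modulus of `x ^ (-s)` for `x` a positive real. -/
theorem norm_ofReal_cpow_neg_sq {x : ℝ} (hx : 0 < x) (s : ℂ) :
    ‖(x : ℂ) ^ (-s)‖ ^ 2 = x ^ (-(2 * s.re)) := by
  rw [Complex.norm_cpow_eq_rpow_re_of_pos hx, ← Real.rpow_natCast, ← Real.rpow_mul hx.le,
    Complex.neg_re]
  congr 1
  push_cast
  ring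


/-- Partial-reproducing-kernel lower bound: if the composition operator f ↦ f∘φ maps ℋ²
into ℋ²_Λ with squared norm at most C, then for every w with Re w > σ_Λ/2,
ζ(2 Re φ(w)) ≤ C·ζ_Λ(2 Re w). Here `a n` is the coefficient of (n+1)^{−s}, while the
coefficients `b n` (supported on Λ, a set of positive integers) are indexed by n itself. -/
theorem stmt16 (Λ : Set ℕ) (hΛ0 : 0 ∉ Λ) (σΛ : ℝ)
    (hΛ : ∀ σ : ℝ, σΛ < σ → Summable fun n : Λ => ((n : ℕ) : ℝ) ^ (-σ))
    (φ : ℂ → ℂ) (hφ : ∀ s : ℂ, σΛ / 2 < s.re → 1 / 2 < (φ s).re)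
    (C : ℝ) (hC0 : 0 ≤ C)
    (hbd : ∀ a : ℕ → ℂ, Summable (fun n => ‖a n‖ ^ 2) →
      ∃ b : ℕ → ℂ, Summable (fun n => ‖b n‖ ^ 2) ∧
        (∀ n : ℕ, n ∉ Λ → b n = 0) ∧
        (∑' n : ℕ, ‖b n‖ ^ 2) ≤ C * ∑' n : ℕ, ‖a n‖ ^ 2 ∧
        (∀ s : ℂ, σΛ / 2 < s.re →
          ∑' n : ℕ, b n * (n : ℂ) ^ (-s) =
            ∑' n : ℕ, a n * ((n : ℂ) + 1) ^ (-(φ s)))) :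
    ∀ w : ℂ, σΛ / 2 < w.re →
      (∑' n : ℕ, ((n : ℝ) + 1) ^ (-(2 * (φ w).re))) ≤
        C * ∑' n : Λ, ((n : ℕ) : ℝ) ^ (-(2 * w.re)) := by
  intro w hw
  set S := ∑' n : ℕ, ((n : ℝ) + 1) ^ (-(2 * (φ w).re)) with hS
  set k : ℕ → ℂ := fun n => ((n : ℂ) + 1) ^ (-(φ w)) with hk
  have hk_norm (n : ℕ) : ‖k n‖ ^ 2 = ((n : ℝ) + 1) ^ (-(2 * (φ w).re)) := by
    rw [← norm_ofReal_cpow_neg_sq (by positivity)]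
    simp [hk]
  have hS_summable : Summable fun n : ℕ => ((n : ℝ) + 1) ^ (-(2 * (φ w).re)) := by
    have h := (summable_nat_add_iff 1).2
      (Real.summable_nat_rpow.2 (by linarith [hφ w hw] : -(2 * (φ w).re) < -1))
    simpa using h
  have hS_pos : 0 < S := hS_summable.tsum_pos (fun n => by positivity) 0 (by positivity)
  have ha_norm (n : ℕ) :
      ‖starRingEnd ℂ (k n)‖ ^ 2 = ((n : ℝ) + 1) ^ (-(2 * (φ w).re)) := by
    rw [RCLike.norm_conj, hk_norm]
  obtain ⟨b, hb, hbΛ, hbC, hb_eq⟩ := hbd (fun n => starRingEnd ℂ (k n))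
    (by simpa only [ha_norm] using hS_summable)
  simp only [ha_norm, ← hS] at hbC
  have hval : ∑' n : Λ, b n * ((n : ℕ) : ℂ) ^ (-w) = S := by
    rw [tsum_subtype Λ fun n => b n * (n : ℂ) ^ (-w), Set.indicator_eq_self.2, hb_eq w hw, hS,
      Complex.ofReal_tsum]
    · refine tsum_congr fun n => ?_
      rw [← hk_norm, Complex.ofReal_pow]
      exact Complex.conj_mul' (k n)
    · intro n hn
      by_contra h
      exact hn (by simp [hbΛ n h])
  have hg_norm (n : Λ) : ‖((n : ℕ) : ℂ) ^ (-w)‖ ^ 2 = ((n : ℕ) : ℝ) ^ (-(2 * w.re)) := by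
    have hn : 0 < (n : ℕ) := Nat.pos_of_ne_zero fun h => hΛ0 (h ▸ n.2)
    rw [← norm_ofReal_cpow_neg_sq (Nat.cast_pos.2 hn), Complex.ofReal_natCast]
  have hCS := norm_tsum_mul_sq_le (f := fun n : Λ => b n) (g := fun n : Λ => ((n : ℕ) : ℂ) ^ (-w))
    (hb.subtype Λ) (by simpa only [hg_norm] using hΛ (2 * w.re) (by linarith))
  simp only [hg_norm] at hCS
  rw [hval, Complex.norm_real, Real.norm_of_nonneg hS_pos.le] at hCS
  have hbΛ_le : ∑' n : Λ, ‖b n‖ ^ 2 ≤ C * S :=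
    (hb.tsum_subtype_le _ Λ fun _ => sq_nonneg _).trans hbC
  have hZ : 0 ≤ ∑' n : Λ, ((n : ℕ) : ℝ) ^ (-(2 * w.re)) := tsum_nonneg fun _ => by positivity
  refine le_of_mul_le_mul_right ?_ hS_pos
  nlinarith [mul_le_mul_of_nonneg_right hbΛ_le hZ]
end
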